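/- Let H = L²(S¹, ℂⁿ), S the forward shift, and H₊ the Hardy space. If W ⊆ H is a closed subspace with λˢH₊ ⊆ W ⊆ λ⁻ʳH₊ for some natural numbers r, s, then S|W is a pure shift (⋂_{k} SᵏW = {0}) of multiplicity n (dim(W ⊖ SW) = n). -/

import Mathlib

open Submodule in
theorem aux_add {V : Type*} [AddCommGroup V] [Module ℂ V] (R P Q : Submodule ℂ V)
    (h1 : Q ≤ P) (h2 : P ≤ R) :
    Module.rank ℂ (R.map P.mkQ) + Module.rank ℂ (P.map Q.mkQ) = Module.rank ℂ (R.map Q.mkQ) := by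
  have hf := LinearMap.rank_range_add_rank_ker ((Q.mapQ P LinearMap.id h1).domRestrict (R.map Q.mkQ))
  rw [← hf]
  congr 1
  · have : LinearMap.range ((Q.mapQ P LinearMap.id h1).domRestrict (R.map Q.mkQ)) = R.map P.mkQ := by
      rw [LinearMap.range_domRestrict, ← Submodule.map_comp]
      rfl
    rw [this]
  · have hk : LinearMap.ker ((Q.mapQ P LinearMap.id h1).domRestrict (R.map Q.mkQ))
        = (P.map Q.mkQ).submoduleOf (R.map Q.mkQ) := by
      rw [LinearMap.ker_domRestrict, Submodule.ker_mapQ]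
      rfl
    rw [hk]
    exact (Submodule.submoduleOfEquivOfLe (Submodule.map_mono h2)).rank_eq.symm

theorem aux_inv {V : Type*} [AddCommGroup V] [Module ℂ V] (F : V ≃ₗ[ℂ] V) (P Q : Submodule ℂ V) :
    Module.rank ℂ ((P.map (F : V →ₗ[ℂ] V)).map (Q.map (F : V →ₗ[ℂ] V)).mkQ)
      = Module.rank ℂ (P.map Q.mkQ) := by
  rw [← (Submodule.Quotient.equiv Q (Q.map (F : V →ₗ[ℂ] V)) F rfl).rank_map_eq (P.map Q.mkQ)]
  have : (P.map (F : V →ₗ[ℂ] V)).map (Q.map (F : V →ₗ[ℂ] V)).mkQ = Submodule.map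
      (Submodule.Quotient.equiv Q (Q.map (F : V →ₗ[ℂ] V)) F rfl : (V ⧸ Q) →ₗ[ℂ] _) (P.map Q.mkQ) := by
    rw [← Submodule.map_comp, ← Submodule.map_comp]
    rfl
  rw [this]

theorem aux_orth {H : Type*} [NormedAddCommGroup H] [InnerProductSpace ℂ H] [CompleteSpace H]
    (P Q : Submodule ℂ H) (hQ : IsClosed (Q : Set H)) (h : Q ≤ P) :
    Module.rank ℂ ↥(P ⊓ Qᗮ) = Module.rank ℂ (P.map Q.mkQ) := by
  have : CompleteSpace Q := hQ.completeSpace_coe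
  have hinj : Function.Injective (Q.mkQ.domRestrict (P ⊓ Qᗮ)) := by
    rw [← LinearMap.ker_eq_bot, LinearMap.ker_eq_bot']
    rintro ⟨x, hx⟩ h0
    have hxQ : x ∈ Q := by simpa using h0
    have : x ∈ Q ⊓ Qᗮ := ⟨hxQ, hx.2⟩
    rw [Submodule.inf_orthogonal_eq_bot] at this
    simpa using this
  rw [(LinearEquiv.ofInjective _ hinj).rank_eq, LinearMap.range_domRestrict]
  have : (P ⊓ Qᗮ).map Q.mkQ = P.map Q.mkQ := by
    apply le_antisymm (Submodule.map_mono inf_le_left)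
    rintro _ ⟨x, hx, rfl⟩
    refine ⟨x - Q.starProjection x, ⟨P.sub_mem hx (h (Q.starProjection_apply_mem x)),
      Q.sub_starProjection_mem_orthogonal x⟩, ?_⟩
    simp
  rw [this]

theorem stmt_14 (H : Type*) [NormedAddCommGroup H] [InnerProductSpace ℂ H] [CompleteSpace H]
    (E : H ≃ₗ[ℂ] H) (hE : ∀ x, ‖E x‖ = ‖x‖)
    (n : ℕ) (Hp : Submodule ℂ H) (hHp : IsClosed (Hp : Set H))
    (hinv : Submodule.map (E : H →ₗ[ℂ] H) Hp ≤ Hp)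
    (hpureHp : (⨅ k : ℕ, Submodule.map ((E ^ k : H ≃ₗ[ℂ] H) : H →ₗ[ℂ] H) Hp) = ⊥)
    [FiniteDimensional ℂ ↥(Hp ⊓ (Submodule.map (E : H →ₗ[ℂ] H) Hp)ᗮ)]
    (hmultHp : Module.finrank ℂ ↥(Hp ⊓ (Submodule.map (E : H →ₗ[ℂ] H) Hp)ᗮ) = n)
    (r s : ℕ) (W : Submodule ℂ H) (hW : IsClosed (W : Set H))
    (hWinv : Submodule.map (E : H →ₗ[ℂ] H) W ≤ W)
    (h1 : Submodule.map ((E ^ (s : ℤ) : H ≃ₗ[ℂ] H) : H →ₗ[ℂ] H) Hp ≤ W)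
    (h2 : W ≤ Submodule.map ((E ^ (-(r : ℤ)) : H ≃ₗ[ℂ] H) : H →ₗ[ℂ] H) Hp) :
    (⨅ k : ℕ, Submodule.map ((E ^ k : H ≃ₗ[ℂ] H) : H →ₗ[ℂ] H) W) = ⊥ ∧
    FiniteDimensional ℂ ↥(W ⊓ (Submodule.map (E : H →ₗ[ℂ] H) W)ᗮ) ∧
    Module.finrank ℂ ↥(W ⊓ (Submodule.map (E : H →ₗ[ℂ] H) W)ᗮ) = n := by
  have hiso : Isometry E := AddMonoidHomClass.isometry_of_norm E hE
  have hcl : ∀ P : Submodule ℂ H, IsClosed (P : Set H) →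
      IsClosed ((P.map (E : H →ₗ[ℂ] H) : Submodule ℂ H) : Set H) := by
    intro P hP
    rw [Submodule.map_coe]
    exact hiso.isClosedEmbedding.isClosedMap _ hP
  have hmm : ∀ (F G : H ≃ₗ[ℂ] H) (P : Submodule ℂ H),
      (P.map (G : H →ₗ[ℂ] H)).map (F : H →ₗ[ℂ] H) = P.map ((F * G : H ≃ₗ[ℂ] H) : H →ₗ[ℂ] H) := by
    intro F G P
    rw [← Submodule.map_comp]
    rfl
  constructor
  · rw [eq_bot_iff]
    intro x hx
    have key : (E ^ r) x ∈ (⨅ k : ℕ, Submodule.map ((E ^ k : H ≃ₗ[ℂ] H) : H →ₗ[ℂ] H) Hp) := by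
      rw [Submodule.mem_iInf] at hx ⊢
      intro k
      obtain ⟨w, hw, hwx⟩ := hx k
      obtain ⟨y, hy, hyw⟩ := h2 hw
      refine ⟨y, hy, ?_⟩
      have e : (E ^ r * E ^ k * E ^ (-(r:ℤ)) : H ≃ₗ[ℂ] H) = E ^ k := by
        rw [← zpow_natCast, ← zpow_natCast, ← zpow_add, ← zpow_add]
        congr 1
        ring
      rw [← hwx, ← hyw]
      exact (congrArg (fun F : H ≃ₗ[ℂ] H => F y) e).symm
    rw [hpureHp] at key
    simpa using key
  · have hHrank : Module.rank ℂ (Hp.map (Hp.map (E : H →ₗ[ℂ] H)).mkQ) = n := by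
      rw [← aux_orth _ _ (hcl _ hHp) hinv, ← hmultHp, Module.finrank_eq_rank]
    have hle : ∀ k : ℕ, Hp.map ((E ^ (k+1) : H ≃ₗ[ℂ] H) : H →ₗ[ℂ] H)
        ≤ Hp.map ((E ^ k : H ≃ₗ[ℂ] H) : H →ₗ[ℂ] H) := by
      intro k
      rw [pow_succ, ← hmm]
      exact Submodule.map_mono hinv
    have hle0 : ∀ k : ℕ, Hp.map ((E ^ k : H ≃ₗ[ℂ] H) : H →ₗ[ℂ] H) ≤ Hp := by
      intro k
      induction k with
      | zero => 
        rintro _ ⟨x, hx, rfl⟩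
        simpa using hx
      | succ k ih => exact (hle k).trans ih
    have hfin : ∀ k : ℕ, Module.rank ℂ (Hp.map (Hp.map ((E ^ k : H ≃ₗ[ℂ] H) : H →ₗ[ℂ] H)).mkQ)
        < Cardinal.aleph0 := by
      intro k
      induction k with
      | zero =>
        have : Hp.map (Hp.map ((E ^ 0 : H ≃ₗ[ℂ] H) : H →ₗ[ℂ] H)).mkQ = ⊥ := by
          rw [← le_bot_iff, Submodule.map_le_iff_le_comap, Submodule.comap_bot, Submodule.ker_mkQ]
          intro x hx
          exact ⟨x, hx, by simp⟩
        rw [this, rank_bot]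
        exact Cardinal.aleph0_pos
      | succ k ih =>
        rw [← aux_add _ _ _ (hle k) (hle0 k)]
        refine Cardinal.add_lt_aleph0 ih ?_
        rw [pow_succ, ← hmm, aux_inv, hHrank]
        exact Cardinal.natCast_lt_aleph0
    set A := Hp.map ((E ^ (-(r : ℤ)) : H ≃ₗ[ℂ] H) : H →ₗ[ℂ] H) with hA
    set C := Hp.map ((E ^ (s : ℤ) : H ≃ₗ[ℂ] H) : H →ₗ[ℂ] H) with hC
    have hAC : Module.rank ℂ (A.map C.mkQ) < Cardinal.aleph0 := by
      have e : C = (Hp.map ((E ^ (r + s) : H ≃ₗ[ℂ] H) : H →ₗ[ℂ] H)).map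
          ((E ^ (-(r : ℤ)) : H ≃ₗ[ℂ] H) : H →ₗ[ℂ] H) := by
        rw [hmm, hC, ← zpow_natCast, ← zpow_add]
        congr 3
        push_cast
        ring
      rw [e, hA, aux_inv]
      exact hfin _
    have eEC : C.map (E : H →ₗ[ℂ] H) = (Hp.map (E : H →ₗ[ℂ] H)).map
        ((E ^ (s : ℤ) : H ≃ₗ[ℂ] H) : H →ₗ[ℂ] H) := by
      rw [hC, hmm, hmm, ← zpow_one_add, ← zpow_add_one, add_comm]
    have hECC : C.map (E : H →ₗ[ℂ] H) ≤ C := by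
      rw [eEC]
      exact Submodule.map_mono hinv
    have hCr : Module.rank ℂ (C.map (C.map (E : H →ₗ[ℂ] H)).mkQ) = n := by
      rw [eEC, hC, aux_inv, hHrank]
    have a1 := aux_add A W C h1 h2
    have a2 := aux_add A C _ hECC (h1.trans h2)
    have a3 := aux_add A W _ hWinv h2
    have a4 := aux_add A (W.map (E : H →ₗ[ℂ] H)) (C.map (E : H →ₗ[ℂ] H)) (Submodule.map_mono h1)
      (hWinv.trans h2)
    rw [aux_inv] at a4
    have key : Module.rank ℂ (W.map (W.map (E : H →ₗ[ℂ] H)).mkQ) = n := by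
      rw [hCr, ← a4, ← a3] at a2
      have e : Module.rank ℂ (A.map C.mkQ) + n =
          Module.rank ℂ (A.map C.mkQ) + Module.rank ℂ (W.map (W.map (E : H →ₗ[ℂ] H)).mkQ) := by
        rw [a2, ← a1]
        ring
      exact (Cardinal.eq_of_add_eq_add_left e hAC).symm
    rw [← aux_orth _ _ (hcl _ hW) hWinv] at key
    exact ⟨Module.rank_lt_aleph0_iff.mp (key ▸ Cardinal.natCast_lt_aleph0),
      Module.finrank_eq_of_rank_eq key⟩
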